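/- arXiv:2601.04125 — 5 statements merged into one kernel-verified Lean document; each statement's English description precedes it below -/
import Mathlib

section
/- Suppose the field F has more than n−k elements and 1 < k < n−1. Then for every non-degenerate (k+1)-dimensional subspace Y of F^n and every (k−1)-dimensional subspace X of F^n with X ⊆ Y, there exists a non-degenerate k-dimensional subspace A of F^n with X ⊆ A ⊆ Y. -/
open Module

section Defs

variable (F : Type*) [Field F]

/-- The `i`-th coordinate hyperplane in `F^n`: the kernel of the `i`-th coordinate functional. -/
def coordHyp (n : ℕ) (i : Fin n) : Submodule F (Fin n → F) :=
  LinearMap.ker (LinearMap.proj (R := F) (φ := fun _ : Fin n => F) i)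

/-- A subspace of `F^n` is degenerate if it is contained in some coordinate hyperplane. -/
def IsDeg (n : ℕ) (W : Submodule F (Fin n → F)) : Prop :=
  ∃ i : Fin n, W ≤ coordHyp F n i

/-- A subspace of `F^n` is non-degenerate if it is not degenerate. -/
def IsNondeg (n : ℕ) (W : Submodule F (Fin n → F)) : Prop :=
  ¬ IsDeg F n W

/-- Adjacency of `k`-dimensional subspaces: distinct with `(k-1)`-dimensional intersection. -/
def AdjK (n k : ℕ) (A B : Submodule F (Fin n → F)) : Prop :=
  A ≠ B ∧ finrank F ↥(A ⊓ B) = k - 1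

/-- The star `S(X)`: all `k`-dimensional subspaces containing `X`. -/
def Sstar (n k : ℕ) (X : Submodule F (Fin n → F)) : Set (Submodule F (Fin n → F)) :=
  {A | finrank F ↥A = k ∧ X ≤ A}

/-- `S^c(X)`: all non-degenerate `k`-dimensional subspaces containing `X`. -/
def Sc (n k : ℕ) (X : Submodule F (Fin n → F)) : Set (Submodule F (Fin n → F)) :=
  {A | finrank F ↥A = k ∧ X ≤ A ∧ IsNondeg F n A}

/-- `T^c(Y)`: all non-degenerate `k`-dimensional subspaces contained in `Y`. -/
def Tc (n k : ℕ) (Y : Submodule F (Fin n → F)) : Set (Submodule F (Fin n → F)) :=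
  {A | finrank F ↥A = k ∧ A ≤ Y ∧ IsNondeg F n A}

/-- A clique of `Δ_k(V)`: a set of non-degenerate `k`-dimensional subspaces which are
pairwise adjacent. -/
def IsCliqueD (n k : ℕ) (C : Set (Submodule F (Fin n → F))) : Prop :=
  (∀ A ∈ C, finrank F ↥A = k ∧ IsNondeg F n A) ∧
    ∀ A ∈ C, ∀ B ∈ C, A ≠ B → AdjK F n k A B

/-- A maximal clique of `Δ_k(V)`. -/
def IsMaxCliqueD (n k : ℕ) (C : Set (Submodule F (Fin n → F))) : Prop :=
  IsCliqueD F n k C ∧ ∀ D, IsCliqueD F n k D → C ⊆ D → D = C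

/-- A star of `Δ_k(V)`: a set `S^c(X)` which is a maximal clique of `Δ_k(V)`. -/
def IsStarD (n k : ℕ) (S : Set (Submodule F (Fin n → F))) : Prop :=
  (∃ X : Submodule F (Fin n → F), finrank F ↥X = k - 1 ∧ S = Sc F n k X) ∧
    IsMaxCliqueD F n k S

/-- A top of `Δ_k(V)`: a set `T^c(Y)` which is a maximal clique of `Δ_k(V)`. -/
def IsTopD (n k : ℕ) (T : Set (Submodule F (Fin n → F))) : Prop :=
  (∃ Y : Submodule F (Fin n → F), finrank F ↥Y = k + 1 ∧ T = Tc F n k Y) ∧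
    IsMaxCliqueD F n k T

/-- Adjacency of maximal cliques used in the graphs `Δ_s` and `Δ_t`:
two distinct cliques such that every vertex of each is adjacent to some vertex of the other. -/
def AdjMC (n k : ℕ) (C1 C2 : Set (Submodule F (Fin n → F))) : Prop :=
  C1 ≠ C2 ∧ (∀ A ∈ C1, ∃ B ∈ C2, AdjK F n k A B) ∧
    (∀ A ∈ C2, ∃ B ∈ C1, AdjK F n k A B)

/-- Adjacency in the graphs `Δ'_s` and `Δ'_t`: adjacent as above with empty intersection. -/
def AdjMC' (n k : ℕ) (C1 C2 : Set (Submodule F (Fin n → F))) : Prop :=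
  AdjMC F n k C1 C2 ∧ C1 ∩ C2 = ∅

/-- A clique of the graph `Δ_s` (whose vertices are the stars of `Δ_k(V)`). -/
def IsCliqueDs (n k : ℕ) (𝔖 : Set (Set (Submodule F (Fin n → F)))) : Prop :=
  (∀ S ∈ 𝔖, IsStarD F n k S) ∧ ∀ S ∈ 𝔖, ∀ S' ∈ 𝔖, S ≠ S' → AdjMC F n k S S'

/-- A maximal clique of `Δ_s`. -/
def IsMaxCliqueDs (n k : ℕ) (𝔖 : Set (Set (Submodule F (Fin n → F)))) : Prop :=
  IsCliqueDs F n k 𝔖 ∧ ∀ 𝔖', IsCliqueDs F n k 𝔖' → 𝔖 ⊆ 𝔖' → 𝔖' = 𝔖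

/-- A clique of the graph `Δ'_s`. -/
def IsCliqueDs' (n k : ℕ) (𝔖 : Set (Set (Submodule F (Fin n → F)))) : Prop :=
  (∀ S ∈ 𝔖, IsStarD F n k S) ∧ ∀ S ∈ 𝔖, ∀ S' ∈ 𝔖, S ≠ S' → AdjMC' F n k S S'

/-- A maximal clique of `Δ'_s`. -/
def IsMaxCliqueDs' (n k : ℕ) (𝔖 : Set (Set (Submodule F (Fin n → F)))) : Prop :=
  IsCliqueDs' F n k 𝔖 ∧ ∀ 𝔖', IsCliqueDs' F n k 𝔖' → 𝔖 ⊆ 𝔖' → 𝔖' = 𝔖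

/-- A special set of stars: a maximal clique in both `Δ_s` and `Δ'_s`. -/
def IsSpecialStars (n k : ℕ) (𝔖 : Set (Set (Submodule F (Fin n → F)))) : Prop :=
  IsMaxCliqueDs F n k 𝔖 ∧ IsMaxCliqueDs' F n k 𝔖

/-- A clique of the graph `Δ_t` (whose vertices are the tops of `Δ_k(V)`). -/
def IsCliqueDt (n k : ℕ) (𝔗 : Set (Set (Submodule F (Fin n → F)))) : Prop :=
  (∀ T ∈ 𝔗, IsTopD F n k T) ∧ ∀ T ∈ 𝔗, ∀ T' ∈ 𝔗, T ≠ T' → AdjMC F n k T T'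

/-- A maximal clique of `Δ_t`. -/
def IsMaxCliqueDt (n k : ℕ) (𝔗 : Set (Set (Submodule F (Fin n → F)))) : Prop :=
  IsCliqueDt F n k 𝔗 ∧ ∀ 𝔗', IsCliqueDt F n k 𝔗' → 𝔗 ⊆ 𝔗' → 𝔗' = 𝔗

/-- A clique of the graph `Δ'_t`. -/
def IsCliqueDt' (n k : ℕ) (𝔗 : Set (Set (Submodule F (Fin n → F)))) : Prop :=
  (∀ T ∈ 𝔗, IsTopD F n k T) ∧ ∀ T ∈ 𝔗, ∀ T' ∈ 𝔗, T ≠ T' → AdjMC' F n k T T'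

/-- A maximal clique of `Δ'_t`. -/
def IsMaxCliqueDt' (n k : ℕ) (𝔗 : Set (Set (Submodule F (Fin n → F)))) : Prop :=
  IsCliqueDt' F n k 𝔗 ∧ ∀ 𝔗', IsCliqueDt' F n k 𝔗' → 𝔗 ⊆ 𝔗' → 𝔗' = 𝔗

/-- A special set of tops: a maximal clique in both `Δ_t` and `Δ'_t`. -/
def IsSpecialTops (n k : ℕ) (𝔗 : Set (Set (Submodule F (Fin n → F)))) : Prop :=
  IsMaxCliqueDt F n k 𝔗 ∧ IsMaxCliqueDt' F n k 𝔗

/-- `𝔗_X`: the set of all `T^c(Y)` over non-degenerate `(k+1)`-dimensional `Y` containing `X`. -/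
def TopsThrough (n k : ℕ) (X : Submodule F (Fin n → F)) :
    Set (Set (Submodule F (Fin n → F))) :=
  {T | ∃ Y : Submodule F (Fin n → F),
    finrank F ↥Y = k + 1 ∧ IsNondeg F n Y ∧ X ≤ Y ∧ T = Tc F n k Y}

end Defs

theorem finrank_add_card_le_of_le_coordHyp {F : Type*} [Field F] {n : ℕ}
    {W : Submodule F (Fin n → F)} {I : Finset (Fin n)} (hI : ∀ i ∈ I, W ≤ coordHyp F n i) :
    finrank F W + I.card ≤ n := by
  let f : W →ₗ[F] ({i // i ∉ I} → F) :=
    LinearMap.pi fun i => (LinearMap.proj (i : Fin n)).comp W.subtype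
  have hf : Function.Injective f := by
    intro x y hxy
    ext i
    by_cases hi : i ∈ I
    · have hx : (x : Fin n → F) i = 0 := hI i hi x.2
      have hy : (y : Fin n → F) i = 0 := hI i hi y.2
      rw [hx, hy]
    · exact congrFun hxy ⟨i, hi⟩
  have h := LinearMap.finrank_le_finrank_of_injective hf
  rw [Module.finrank_fintype_fun_eq_card, Fintype.card_subtype_compl, Fintype.card_fin,
    Fintype.card_coe] at h
  have hc : I.card ≤ n := by simpa using I.card_le_univ
  omega

/-- Lemma: existence of a non-degenerate `k`-dimensional subspace between
`X` and `Y`. -/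
theorem stmt0 (F : Type*) [Field F] (n k : ℕ)
    (hk1 : 1 < k) (hk2 : k < n - 1)
    (hF : (↑(n - k) : Cardinal) < Cardinal.mk F)
    (Y : Submodule F (Fin n → F)) (hYrk : finrank F ↥Y = k + 1) (hYnd : IsNondeg F n Y)
    (X : Submodule F (Fin n → F)) (hXrk : finrank F ↥X = k - 1) (hXY : X ≤ Y) :
    ∃ A : Submodule F (Fin n → F),
      finrank F ↥A = k ∧ IsNondeg F n A ∧ X ≤ A ∧ A ≤ Y := by
  classical
  have hlt : ∀ {W : Submodule F (Fin n → F)}, W ≤ Y → finrank F W < k + 1 → ∃ v ∈ Y, v ∉ W := by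
    intro W hW hr
    refine SetLike.exists_of_lt (lt_of_le_of_ne hW ?_)
    rintro rfl
    omega
  have hsing : ∀ {v}, v ∈ Y → Submodule.span F {v} ≤ Y := fun hv => by simpa using hv
  obtain ⟨b, hbY, hbX⟩ := hlt hXY (by omega)
  have hX₁ := Submodule.finrank_sup_span_singleton hbX
  have hX₁Y : X ⊔ Submodule.span F {b} ≤ Y := sup_le hXY (hsing hbY)
  by_cases hdeg : IsDeg F n (X ⊔ Submodule.span F {b})
  swap
  · exact ⟨_, by omega, hdeg, le_sup_left, hX₁Y⟩
  obtain ⟨i₀, hi₀⟩ := hdeg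
  obtain ⟨a, haY, haX₁⟩ := hlt hX₁Y (by omega)
  have hY : X ⊔ Submodule.span F {b} ⊔ Submodule.span F {a} = Y := by
    apply Submodule.eq_of_le_of_finrank_eq (sup_le hX₁Y (hsing haY))
    rw [Submodule.finrank_sup_span_singleton haX₁]
    omega
  have hYi : ∀ i, X ≤ coordHyp F n i → b i = 0 → a i ≠ 0 := by
    intro i hX hb ha
    refine hYnd ⟨i, hY ▸ sup_le (sup_le hX ?_) ?_⟩
    · simpa [coordHyp] using hb
    · simpa [coordHyp] using ha
  let I : Finset (Fin n) := {i | X ≤ coordHyp F n i}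
  have hI : finrank F X + I.card ≤ n :=
    finrank_add_card_le_of_le_coordHyp fun i hi => (Finset.mem_filter.mp hi).2
  have hi₀I : i₀ ∈ I := by simpa [I] using le_sup_left.trans hi₀
  have hbi₀ : b i₀ = 0 := hi₀ (Submodule.mem_sup_right (Submodule.mem_span_singleton_self b))
  have hcard : ((I.erase i₀).image fun i => -a i / b i).card ≤ n - k := by
    refine Finset.card_image_le.trans ?_
    rw [Finset.card_erase_of_mem hi₀I]
    omega
  obtain ⟨t, ht⟩ := Cardinal.exists_notMem_of_length_lt
    ((I.erase i₀).image fun i => -a i / b i).toList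
    ((Nat.cast_le.mpr (by rwa [Finset.length_toList])).trans_lt hF)
  rw [Finset.mem_toList] at ht
  have hv : a + t • b ∉ X := fun h => haX₁ <| by
    have h' := Submodule.sub_mem _ (Submodule.mem_sup_left (T := Submodule.span F {b}) h)
      (Submodule.mem_sup_right (Submodule.smul_mem _ t (Submodule.mem_span_singleton_self b)))
    rwa [add_sub_cancel_right] at h'
  refine ⟨X ⊔ Submodule.span F {a + t • b}, ?_, ?_, le_sup_left,
    sup_le hXY (hsing (Y.add_mem haY (Y.smul_mem t hbY)))⟩
  · rw [Submodule.finrank_sup_span_singleton hv]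
    omega
  · rintro ⟨i, hi⟩
    have hXi : X ≤ coordHyp F n i := le_sup_left.trans hi
    have hz : a i + t * b i = 0 :=
      hi (Submodule.mem_sup_right (Submodule.mem_span_singleton_self (a + t • b)))
    have hbi : b i ≠ 0 := fun hb => hYi i hXi hb (by simpa [hb] using hz)
    refine ht (Finset.mem_image.mpr ⟨i, Finset.mem_erase.mpr ⟨?_, by simpa [I] using hXi⟩, ?_⟩)
    · rintro rfl
      exact hbi hbi₀
    · rw [div_eq_iff hbi]
      linear_combination -hz
end

section
/- Suppose the field F has more than n−k elements and 1 < k < n−1. Then for every non-degenerate (k+1)-dimensional subspace Y of F^n, the set T^c(Y) is a maximal clique of Δ_k(V) (i.e., a top of Δ_k(V)). -/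
open Module

section Helpers

variable {F : Type*} [Field F]

theorem finrank_dual_apply_eq_zero {W : Type*} [AddCommGroup W] [Module F W]
    [FiniteDimensional F W] {x : W} (hx : x ≠ 0) :
    finrank F (LinearMap.ker (Dual.eval F W x)) + 1 = finrank F W := by
  have h : Dual.eval F W x ≠ 0 := fun h ↦ hx ((Module.eval_apply_eq_zero_iff F x).1 h)
  rw [Module.Dual.finrank_ker_add_one_of_ne_zero h, Subspace.dual_finrank_eq]

/-- If `F` contains `t` elements, then at least `t ^ k` functionals on a `(k + 1)`-dimensional
space take the value `1` at a given nonzero vector; so they are not covered by a family of fewer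
than `t ^ k` functionals. -/
theorem exists_dual_apply_eq_one_notMem_range {W ι : Type*} [AddCommGroup W] [Module F W]
    [FiniteDimensional F W] [Fintype ι] {k : ℕ} (hW : finrank F W = k + 1) (T : Finset F)
    (hT : Fintype.card ι < T.card ^ k) {x : W} (hx : x ≠ 0) (g : ι → Dual F W) :
    ∃ f : Dual F W, f x = 1 ∧ f ∉ Set.range g := by
  classical
  obtain ⟨f₀, hf₀⟩ : ∃ f : Dual F W, f x = 1 := by
    obtain ⟨f, hf⟩ : ∃ f : Dual F W, f x ≠ 0 := by
      by_contra! h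
      exact hx ((Module.forall_dual_apply_eq_zero_iff F x).1 h)
    exact ⟨(f x)⁻¹ • f, by simp [hf]⟩
  let K : Submodule F (Dual F W) := LinearMap.ker (Dual.eval F W x)
  have hK : finrank F (Fin k → F) = finrank F K := by
    have := finrank_dual_apply_eq_zero (F := F) hx
    rw [finrank_fin_fun]
    simp only [K]
    omega
  have : Free F K := Free.of_divisionRing F K
  let e := LinearEquiv.ofFinrankEq _ _ hK
  let φ : (Fin k → T) → Dual F W := fun v ↦ f₀ + e (fun i ↦ v i)
  have hφ : Function.Injective φ := by
    intro v w h
    have := e.injective (Subtype.ext (add_left_cancel h))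
    exact funext fun i ↦ Subtype.ext (congrFun this i)
  by_contra! h
  have hmem (v) : φ v ∈ Set.range g := by
    apply h
    have : (e (fun i ↦ (v i : F)) : Dual F W) x = 0 := (e (fun i ↦ (v i : F))).2
    simp [φ, hf₀, this]
  choose ψ hψ using hmem
  have hinj : Function.Injective ψ := fun v w hvw ↦ hφ (by rw [← hψ v, ← hψ w, hvw])
  have := Fintype.card_le_of_injective ψ hinj
  simp at this
  omega

theorem add_le_pow {t k : ℕ} (ht : 2 ≤ t) (hk : 2 ≤ k) : t + k ≤ t ^ k := by
  induction k, hk using Nat.le_induction with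
  | base => nlinarith
  | succ k hk ih => rw [pow_succ]; nlinarith

/-- Every nonzero vector of `Y` is avoided by some member of `T^c(Y)`. -/
theorem exists_mem_Tc_notMem {n k : ℕ} (hk1 : 1 < k) (hk2 : k < n)
    (hF : (↑(n - k) : Cardinal) < Cardinal.mk F)
    {Y : Submodule F (Fin n → F)} (hYrk : finrank F Y = k + 1) (hYnd : IsNondeg F n Y)
    {x : Fin n → F} (hxY : x ∈ Y) (hx : x ≠ 0) : ∃ H ∈ Tc F n k Y, x ∉ H := by
  obtain ⟨T, hT⟩ : ∃ T : Finset F, n - k + 1 = T.card :=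
    Cardinal.exists_finset_eq_card
      (by rw [Nat.cast_succ, ← Cardinal.succ_natCast]; exact Order.succ_le_of_lt hF)
  have hcard : Fintype.card (Fin n) < T.card ^ k := by
    have := add_le_pow (t := T.card) (k := k) (by omega) hk1
    rw [Fintype.card_fin]
    omega
  let y : Fin n → Dual F Y := fun i ↦ LinearMap.proj i ∘ₗ Y.subtype
  obtain ⟨f, hfx, hf⟩ := exists_dual_apply_eq_one_notMem_range hYrk T hcard
    (x := (⟨x, hxY⟩ : Y)) (by simpa using hx) (fun i ↦ (y i ⟨x, hxY⟩)⁻¹ • y i)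
  have hf0 : f ≠ 0 := by
    rintro rfl
    simp at hfx
  refine ⟨(LinearMap.ker f).map Y.subtype, ⟨?_, Submodule.map_subtype_le _ _, ?_⟩, ?_⟩
  · rw [Submodule.finrank_map_subtype_eq]
    have := Module.Dual.finrank_ker_add_one_of_ne_zero hf0
    omega
  · rintro ⟨i, hi⟩
    have hker : LinearMap.ker f ≤ LinearMap.ker (y i) := fun v hv ↦
      hi (Submodule.mem_map_of_mem hv)
    obtain ⟨c, hc⟩ : ∃ c : F, y i = c • f := by
      refine ⟨y i ⟨x, hxY⟩, LinearMap.ext fun v ↦ ?_⟩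
      have hv : v - f v • ⟨x, hxY⟩ ∈ LinearMap.ker f := by
        rw [LinearMap.mem_ker, map_sub, map_smul, hfx, smul_eq_mul, mul_one, sub_self]
      have := hker hv
      rw [LinearMap.mem_ker, map_sub, map_smul, sub_eq_zero] at this
      rw [this, LinearMap.smul_apply, smul_eq_mul, smul_eq_mul, mul_comm]
    have hc0 : c ≠ 0 := by
      rintro rfl
      refine hYnd ⟨i, fun v hv ↦ ?_⟩
      simpa [y, coordHyp] using LinearMap.congr_fun hc ⟨v, hv⟩
    exact hf ⟨i, by simp [hc, hfx, hc0]⟩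
  · rintro ⟨v, hv, hvx⟩
    obtain rfl : v = ⟨x, hxY⟩ := Subtype.ext hvx
    have : f ⟨x, hxY⟩ = 0 := hv
    simp [hfx] at this

theorem isCliqueD_Tc {n k : ℕ} {Y : Submodule F (Fin n → F)} (hYrk : finrank F Y = k + 1) :
    IsCliqueD F n k (Tc F n k Y) := by
  refine ⟨fun A hA ↦ ⟨hA.1, hA.2.2⟩, fun A hA B hB hAB ↦ ⟨hAB, ?_⟩⟩
  have hlt : A < A ⊔ B := by
    refine lt_of_le_of_ne le_sup_left fun h ↦ hAB ?_
    have hBA : B ≤ A := by rw [h]; exact le_sup_right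
    exact (Submodule.eq_of_le_of_finrank_eq hBA (hB.1.trans hA.1.symm)).symm
  have h1 := Submodule.finrank_lt_finrank_of_lt hlt
  have h2 := Submodule.finrank_mono (sup_le hA.2.1 hB.2.1)
  have h3 := Submodule.finrank_sup_add_finrank_inf_eq A B
  have h4 := hA.1
  have h5 := hB.1
  omega

end Helpers

/-- if `|F| > n - k`, then `T^c(Y)` is a top of `Δ_k(V)` for every
non-degenerate `(k+1)`-dimensional subspace `Y`. -/
theorem stmt1 (F : Type*) [Field F] (n k : ℕ)
    (hk1 : 1 < k) (hk2 : k < n - 1)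
    (hF : (↑(n - k) : Cardinal) < Cardinal.mk F)
    (Y : Submodule F (Fin n → F)) (hYrk : finrank F ↥Y = k + 1) (hYnd : IsNondeg F n Y) :
    IsMaxCliqueD F n k (Tc F n k Y) := by
  refine ⟨isCliqueD_Tc hYrk, fun D hD hCD ↦ Set.Subset.antisymm (fun A hA ↦ ?_) hCD⟩
  obtain ⟨hAk, hAnd⟩ := hD.1 A hA
  by_contra hAC
  have hAY : ¬ A ≤ Y := fun h ↦ hAC ⟨hAk, h, hAnd⟩
  have hlt : finrank F ↥(A ⊓ Y) < k := by
    rw [← hAk]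
    exact Submodule.finrank_lt_finrank_of_lt (inf_lt_left.2 hAY)
  have hinf (H) (hH : H ∈ Tc F n k Y) :
      A ⊓ H = A ⊓ Y ∧ finrank F ↥(A ⊓ H) = k - 1 := by
    have h := (hD.2 A hA H (hCD hH) (fun h ↦ hAC (h ▸ hH))).2
    exact ⟨Submodule.eq_of_le_of_finrank_le (inf_le_inf_left A hH.2.1) (by omega), h⟩
  obtain ⟨z, hzY, hz⟩ := Y.exists_mem_ne_zero_of_ne_bot (by rintro rfl; simp at hYrk)
  obtain ⟨H₀, hH₀, -⟩ := exists_mem_Tc_notMem hk1 (by omega) hF hYrk hYnd hzY hz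
  obtain ⟨x, hx, hx0⟩ := (A ⊓ Y).exists_mem_ne_zero_of_ne_bot (by
    intro h
    have := hinf H₀ hH₀
    rw [this.1, h, finrank_bot] at this
    omega)
  obtain ⟨H, hH, hxH⟩ := exists_mem_Tc_notMem hk1 (by omega) hF hYrk hYnd hx.2 hx0
  rw [← (hinf H hH).1] at hx
  exact hxH hx.2
end

section
/- Suppose the field F has at least 3 elements and 1 < k < n−1. Then for every (k−1)-dimensional subspace X of F^n, the set S^c(X) is a maximal clique of Δ_k(V), and there is no (k+1)-dimensional subspace Y of F^n such that S^c(X) = T^c(Y). -/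
open Module

theorem exists_forall_ne_zero_notMem {F : Type*} [Field F] (hF : (3 : Cardinal) ≤ Cardinal.mk F)
    {n : ℕ} {Y : Submodule F (Fin n → F)} (hY : Y ≠ ⊤) :
    ∃ v : Fin n → F, (∀ i, v i ≠ 0) ∧ v ∉ Y := by
  by_contra! h
  obtain ⟨a, ha0, ha1⟩ := Cardinal.exists_ne_ne_of_three_le hF 0 1
  refine hY (top_le_iff.1 ?_)
  rw [← (Pi.basisFun F (Fin n)).span_eq, Submodule.span_le]
  rintro _ ⟨i, rfl⟩
  have h1 : (1 : Fin n → F) ∈ Y := h _ fun _ => one_ne_zero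
  have h2 : Function.update (1 : Fin n → F) i a ∈ Y := by
    refine h _ fun j => ?_
    obtain rfl | hj := eq_or_ne j i
    · simpa using ha0
    · simp [Function.update_of_ne hj]
  have h3 : Pi.basisFun F (Fin n) i =
      (a - 1)⁻¹ • (Function.update (1 : Fin n → F) i a - 1) := by
    ext j
    obtain rfl | hj := eq_or_ne j i
    · simp [inv_mul_cancel₀ (sub_ne_zero.2 ha1)]
    · simp [hj]
  rw [SetLike.mem_coe, h3]
  exact Y.smul_mem _ (Y.sub_mem h2 h1)

theorem exists_mem_Sc_not_le {F : Type*} [Field F] (hF : (3 : Cardinal) ≤ Cardinal.mk F)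
    {n k : ℕ} (hk : 0 < k) {X Y : Submodule F (Fin n → F)} (hX : finrank F X = k - 1)
    (hXY : X ≤ Y) (hY : Y ≠ ⊤) : ∃ A ∈ Sc F n k X, ¬ A ≤ Y := by
  obtain ⟨v, hv, hvY⟩ := exists_forall_ne_zero_notMem hF hY
  have hvA : v ∈ X ⊔ F ∙ v := Submodule.mem_sup_right (Submodule.mem_span_singleton_self v)
  have hlt : X < X ⊔ F ∙ v :=
    lt_of_le_of_ne le_sup_left fun h => hvY (hXY (h ▸ hvA))
  refine ⟨X ⊔ F ∙ v, ⟨?_, le_sup_left, fun ⟨i, hi⟩ => hv i (hi hvA)⟩, fun h => hvY (h hvA)⟩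
  have h1 := Submodule.finrank_lt_finrank_of_lt hlt
  have h2 := Submodule.finrank_add_le_finrank_add_finrank X (F ∙ v)
  have h3 : finrank F (F ∙ v) ≤ 1 := by simpa using finrank_span_le_card (R := F) ({v} : Set (Fin n → F))
  omega

theorem isCliqueD_Sc {F : Type*} [Field F] {n k : ℕ} {X : Submodule F (Fin n → F)}
    (hX : finrank F X = k - 1) : IsCliqueD F n k (Sc F n k X) := by
  refine ⟨fun A hA => ⟨hA.1, hA.2.2⟩, fun A hA B hB hAB => ⟨hAB, ?_⟩⟩
  have h1 := Submodule.finrank_mono (le_inf hA.2.1 hB.2.1)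
  have h2 : A ⊓ B < A := lt_of_le_of_ne inf_le_left fun h =>
    hAB (Submodule.eq_of_le_of_finrank_eq (inf_eq_left.1 h) (hA.1.trans hB.1.symm))
  have h3 := Submodule.finrank_lt_finrank_of_lt h2
  have h4 := hA.1
  omega

theorem le_sup_of_AdjK {F : Type*} [Field F] {n k : ℕ} {X A B : Submodule F (Fin n → F)}
    (hX : finrank F X = k - 1) (hA : finrank F A = k) (hXA : X ≤ A) (hXB : ¬ X ≤ B)
    (hAB : AdjK F n k A B) : A ≤ X ⊔ B := by
  have hlt : X < X ⊔ A ⊓ B := lt_of_le_of_ne le_sup_left fun h => by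
    have h1 : A ⊓ B ≤ X := sup_eq_left.1 h.symm
    have h2 := Submodule.eq_of_le_of_finrank_eq h1 (hAB.2.trans hX.symm)
    exact hXB (h2 ▸ inf_le_right)
  have h1 := Submodule.finrank_lt_finrank_of_lt hlt
  have h2 : X ⊔ A ⊓ B = A :=
    Submodule.eq_of_le_of_finrank_le (sup_le hXA inf_le_left) (by omega)
  refine h2.symm.le.trans ?_
  exact sup_le_sup_left inf_le_right X

/-- if `|F| ≥ 3`, then `S^c(X)` is a maximal clique of `Δ_k(V)` for every
`(k-1)`-dimensional subspace `X`, and it is not of the form `T^c(Y)`. -/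
theorem stmt2 (F : Type*) [Field F] (n k : ℕ)
    (hk1 : 1 < k) (hk2 : k < n - 1)
    (hF : (3 : Cardinal) ≤ Cardinal.mk F)
    (X : Submodule F (Fin n → F)) (hXrk : finrank F ↥X = k - 1) :
    IsMaxCliqueD F n k (Sc F n k X) ∧
      ¬ ∃ Y : Submodule F (Fin n → F), finrank F ↥Y = k + 1 ∧ Sc F n k X = Tc F n k Y := by
  have hne : ∀ Y : Submodule F (Fin n → F), finrank F Y ≤ k + 1 → Y ≠ ⊤ := by
    rintro _ h rfl
    rw [finrank_top, finrank_fin_fun] at h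
    omega
  obtain ⟨A₀, hA₀, -⟩ := exists_mem_Sc_not_le hF (by omega) hXrk le_rfl (hne X (by omega))
  refine ⟨⟨isCliqueD_Sc hXrk, fun D hD hSD => (hSD.antisymm fun B hB => ?_).symm⟩, ?_⟩
  · obtain ⟨hBk, hBn⟩ := hD.1 B hB
    refine ⟨hBk, ?_, hBn⟩
    by_contra hXB
    have hadj : ∀ A ∈ Sc F n k X, AdjK F n k A B := fun A hA =>
      hD.2 A (hSD hA) B hB fun h => hXB (h ▸ hA.2.1)
    have hfin : finrank F ↥(X ⊔ B) ≤ k + 1 := by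
      have h1 := Submodule.finrank_mono (sup_le_sup_right hA₀.2.1 B)
      have h2 := Submodule.finrank_sup_add_finrank_inf_eq A₀ B
      have h3 := (hadj A₀ hA₀).2
      have h4 := hA₀.1
      omega
    obtain ⟨A, hA, hAY⟩ := exists_mem_Sc_not_le hF (by omega) hXrk le_sup_left (hne _ hfin)
    exact hAY (le_sup_of_AdjK hXrk hA.1 hA.2.1 hXB (hadj A hA))
  · rintro ⟨Y, hY, h⟩
    have hle : ∀ A ∈ Sc F n k X, A ≤ Y := fun A hA => (h ▸ hA : A ∈ Tc F n k Y).2.1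
    obtain ⟨A, hA, hAY⟩ := exists_mem_Sc_not_le hF (by omega) hXrk
      (hA₀.2.1.trans (hle A₀ hA₀)) (hne Y hY.le)
    exact hAY (hle A hA)
end

section
/- Suppose F is an infinite field and 1 < k < n−1. Then for every non-degenerate (k+1)-dimensional subspace Y of F^n, the set T^c(Y) is a maximal clique of Δ_k(V) (i.e., a top of Δ_k(V)). -/
open Module

/-- Over an infinite field, some functional is nonzero at a given nonzero vector and proportional
to none of finitely many given functionals. -/
theorem Module.Dual.exists_apply_ne_zero_forall_notMem_span_singleton
    {F W ι : Type*} [Field F] [Infinite F] [AddCommGroup W] [Module F W] [FiniteDimensional F W]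
    [Finite ι] (hW : 1 < finrank F W) (φ : ι → Dual F W) {z : W} (hz : z ≠ 0) :
    ∃ f : Dual F W, f z ≠ 0 ∧ ∀ i, f ∉ Submodule.span F {φ i} := by
  let p : Option ι → Submodule F (Dual F W) := fun o =>
    o.elim (LinearMap.ker (Dual.eval F W z)) fun i => Submodule.span F {φ i}
  have hp : (⋃ o, (p o : Set (Dual F W))) ≠ Set.univ := by
    intro h
    obtain ⟨_ | i, ho⟩ := Subspace.exists_eq_top_of_iUnion_eq_univ h
    · exact hz ((forall_dual_apply_eq_zero_iff F z).mp fun f =>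
        LinearMap.mem_ker.mp (ho.symm ▸ Submodule.mem_top : f ∈ p none))
    · have hle := finrank_span_le_card (R := F) ({φ i} : Set (Dual F W))
      have htop : finrank F (Submodule.span F {φ i}) = finrank F (Dual F W) := by
        rw [← finrank_top F (Dual F W), ← ho]; rfl
      rw [htop, Subspace.dual_finrank_eq] at hle
      simp at hle
      omega
  obtain ⟨f, hf⟩ := (Set.ne_univ_iff_exists_notMem _).mp hp
  simp only [Set.mem_iUnion, not_exists] at hf
  exact ⟨f, hf none, fun i => hf (some i)⟩

/-- A functional vanishing on the kernel of `f` is a multiple of `f`. -/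
theorem Module.Dual.mem_span_singleton_of_ker_le_ker
    {F W : Type*} [Field F] [AddCommGroup W] [Module F W] {f g : Dual F W}
    (h : LinearMap.ker f ≤ LinearMap.ker g) : g ∈ Submodule.span F {f} := by
  simpa using mem_span_of_iInf_ker_le_ker (L := fun _ : Unit => f) (by simpa using h)

/-- Two distinct hyperplanes of a `(k+1)`-dimensional space meet in dimension `k - 1`. -/
theorem Submodule.finrank_inf_of_ne_of_le
    {F V : Type*} [Field F] [AddCommGroup V] [Module F V] [FiniteDimensional F V]
    {k : ℕ} {A B Y : Submodule F V} (hA : finrank F A = k) (hB : finrank F B = k)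
    (hY : finrank F Y = k + 1) (hAY : A ≤ Y) (hBY : B ≤ Y) (hAB : A ≠ B) :
    finrank F ↥(A ⊓ B) = k - 1 := by
  have hsum := Submodule.finrank_sup_add_finrank_inf_eq A B
  have hle := Submodule.finrank_mono (sup_le hAY hBY)
  have hlt : A < A ⊔ B := lt_of_le_of_ne le_sup_left fun h =>
    hAB (Submodule.eq_of_le_of_finrank_eq (h ▸ le_sup_right) (hB.trans hA.symm)).symm
  have := Submodule.finrank_lt_finrank_of_lt hlt
  omega

/-- Over an infinite field, a nonzero vector of a non-degenerate `(k+1)`-dimensional subspace is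
avoided by some non-degenerate hyperplane of that subspace. -/
theorem exists_mem_Tc_notMem_s3
    {F : Type*} [Field F] [Infinite F] {n k : ℕ} (hk : 0 < k) {Y : Submodule F (Fin n → F)}
    (hY : finrank F Y = k + 1) (hYnd : IsNondeg F n Y) {z : Fin n → F} (hzY : z ∈ Y)
    (hz : z ≠ 0) : ∃ A ∈ Tc F n k Y, z ∉ A := by
  let φ : Fin n → Dual F Y := fun i => (LinearMap.proj i : (Fin n → F) →ₗ[F] F) ∘ₗ Y.subtype
  have hφ : ∀ i, φ i ≠ 0 := fun i h => hYnd ⟨i, fun y hy => DFunLike.congr_fun h (⟨y, hy⟩ : Y)⟩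
  obtain ⟨f, hfz, hf⟩ := Dual.exists_apply_ne_zero_forall_notMem_span_singleton
    (by omega : 1 < finrank F Y) φ (z := ⟨z, hzY⟩) (by simpa using hz)
  have hf0 : f ≠ 0 := by rintro rfl; exact hfz rfl
  refine ⟨(LinearMap.ker f).map Y.subtype, ⟨?_, Submodule.map_subtype_le _ _, ?_⟩, ?_⟩
  · have := Dual.finrank_ker_add_one_of_ne_zero hf0
    rw [Submodule.finrank_map_subtype_eq]
    omega
  · rintro ⟨i, hi⟩
    obtain ⟨c, hc⟩ := Submodule.mem_span_singleton.mp <|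
      Dual.mem_span_singleton_of_ker_le_ker (f := f) (g := φ i) fun y hy =>
        hi (Submodule.mem_map_of_mem hy)
    have hc0 : c ≠ 0 := by rintro rfl; exact hφ i (by rw [← hc, zero_smul])
    refine hf i (Submodule.mem_span_singleton.mpr ⟨c⁻¹, ?_⟩)
    rw [← hc, inv_smul_smul₀ hc0]
  · rintro ⟨y, hy, rfl⟩
    exact hfz hy

/-- if `F` is infinite, then `T^c(Y)` is a top of `Δ_k(V)` for every
non-degenerate `(k+1)`-dimensional subspace `Y`. -/
theorem stmt3 (F : Type*) [Field F] [Infinite F] (n k : ℕ)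
    (hk1 : 1 < k) (hk2 : k < n - 1)
    (Y : Submodule F (Fin n → F)) (hYrk : finrank F ↥Y = k + 1) (hYnd : IsNondeg F n Y) :
    IsMaxCliqueD F n k (Tc F n k Y) := by
  refine ⟨⟨fun A hA => ⟨hA.1, hA.2.2⟩, fun A hA B hB hAB =>
    ⟨hAB, Submodule.finrank_inf_of_ne_of_le hA.1 hB.1 hYrk hA.2.1 hB.2.1 hAB⟩⟩,
    fun D hD hTD => hTD.antisymm' fun B hB => ?_⟩
  refine ⟨(hD.1 B hB).1, ?_, (hD.1 B hB).2⟩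
  by_contra hBY
  have hlt := Submodule.finrank_lt_finrank_of_lt
    (inf_le_left.lt_of_ne fun h => hBY (inf_eq_left.mp h))
  rw [(hD.1 B hB).1] at hlt
  have hadj : ∀ A ∈ Tc F n k Y, finrank F ↥(A ⊓ B) = k - 1 := fun A hA =>
    (hD.2 A (hTD hA) B hB fun h => hBY (h ▸ hA.2.1)).2
  have hY0 : Y ≠ ⊥ := by rintro rfl; simp at hYrk
  obtain ⟨y, hy, hy0⟩ := Submodule.exists_mem_ne_zero_of_ne_bot hY0
  obtain ⟨A₀, hA₀, -⟩ := exists_mem_Tc_notMem_s3 (by omega) hYrk hYnd hy hy0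
  have hAB0 : A₀ ⊓ B ≠ ⊥ := by
    intro h
    have := hadj A₀ hA₀
    rw [h, finrank_bot] at this
    omega
  obtain ⟨z, hz, hz0⟩ := Submodule.exists_mem_ne_zero_of_ne_bot hAB0
  have hzY := hA₀.2.1 hz.1
  obtain ⟨A, hA, hzA⟩ := exists_mem_Tc_notMem_s3 (by omega) hYrk hYnd hzY hz0
  have heq : A ⊓ B = B ⊓ Y := Submodule.eq_of_le_of_finrank_le
    (le_inf inf_le_right (inf_le_left.trans hA.2.1)) (by rw [hadj A hA]; omega)
  exact hzA (heq.ge ⟨hz.2, hzY⟩).1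
end

section
/- Suppose the field F has more than n−k elements and 1 < k < n−1. Let X_1 and X_2 be distinct (k−1)-dimensional subspaces of F^n (so that S^c(X_1) and S^c(X_2) are maximal cliques of Δ_k(V)). Then dim(X_1 ∩ X_2) = k−2 if and only if for each i ∈ {1,2} and every A ∈ S^c(X_i) there exists B ∈ S^c(X_{3−i}) with A and B adjacent. -/
open Module

section Helpers

variable {F : Type*} [Field F]

lemma exists_notMem_of_card_lt {α : Type*} (S : Finset α) {m : ℕ} (hS : S.card ≤ m)
    (hm : (m : Cardinal) < Cardinal.mk α) : ∃ t, t ∉ S := by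
  by_contra! h
  have hle : Cardinal.mk α ≤ Cardinal.mk S :=
    Cardinal.mk_le_of_injective (f := fun t => (⟨t, h t⟩ : S))
      fun a b hab => congrArg Subtype.val hab
  rw [Cardinal.mk_coe_finset] at hle
  exact absurd (hle.trans (by exact_mod_cast hS)) (not_le.2 hm)

/-- Given two vectors without a common zero in `I`, one of the points of the line spanned by them
has no zero coordinate in `I`, provided the field is large enough. -/
lemma exists_combination_ne_zero {ι : Type*} (I : Finset ι) {m : ℕ} (hI : I.card ≤ m + 1)
    (hm : (m : Cardinal) < Cardinal.mk F) (a x : ι → F) (h : ∀ i ∈ I, x i ≠ 0 ∨ a i ≠ 0) :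
    (∀ i ∈ I, a i ≠ 0) ∨ ∃ t : F, ∀ i ∈ I, x i + t * a i ≠ 0 := by
  classical
  by_cases ha : ∀ i ∈ I, a i ≠ 0
  · exact .inl ha
  right
  push Not at ha
  obtain ⟨j, hj, haj⟩ := ha
  have hcard : ((I.erase j).image fun i => -x i / a i).card ≤ m := by
    refine Finset.card_image_le.trans ?_
    rw [Finset.card_erase_of_mem hj]
    omega
  obtain ⟨t, ht⟩ := exists_notMem_of_card_lt _ hcard hm
  refine ⟨t, fun i hi h0 => ?_⟩
  by_cases hai : a i = 0
  · rw [hai, mul_zero, add_zero] at h0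
    exact (h i hi).elim (· h0) (· hai)
  · refine ht (Finset.mem_image.2 ⟨i, Finset.mem_erase.2 ⟨?_, hi⟩, ?_⟩)
    · rintro rfl
      exact hai haj
    · rw [div_eq_iff hai]
      linear_combination -h0

/-- Outside every proper subspace there is a vector all of whose coordinates are nonzero. -/
lemma exists_notMem_forall_ne_zero {n : ℕ} (hF : (2 : Cardinal) < Cardinal.mk F)
    (W : Submodule F (Fin n → F)) (hW : W ≠ ⊤) : ∃ v, v ∉ W ∧ ∀ i, v i ≠ 0 := by
  classical
  by_cases h1 : (1 : Fin n → F) ∈ W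
  · obtain ⟨j, hj⟩ : ∃ j, (Pi.single j 1 : Fin n → F) ∉ W := by
      by_contra! h
      refine hW (eq_top_iff.2 ?_)
      rw [← (Pi.basisFun F (Fin n)).span_eq, Submodule.span_le]
      rintro _ ⟨j, rfl⟩
      simpa using h j
    obtain ⟨t, ht⟩ := exists_notMem_of_card_lt ({0, -1} : Finset F) (m := 2)
      Finset.card_le_two (by exact_mod_cast hF)
    simp only [Finset.mem_insert, Finset.mem_singleton, not_or] at ht
    refine ⟨1 + t • Pi.single j 1, fun h => hj ?_, fun i => ?_⟩
    · exact (W.smul_mem_iff ht.1).1 ((W.add_mem_iff_right h1).1 h)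
    · by_cases hij : i = j
      · subst hij
        simpa [add_comm (1 : F), ← eq_neg_iff_add_eq_zero] using ht.2
      · simp [hij]
  · exact ⟨1, h1, fun _ => one_ne_zero⟩

lemma finrank_sup_span_singleton_of_notMem {V : Type*} [AddCommGroup V] [Module F V]
    [FiniteDimensional F V] {W : Submodule F V} {v : V} (hv : v ∉ W) :
    finrank F ↥(W ⊔ F ∙ v) = finrank F W + 1 := by
  have h0 : v ≠ 0 := by
    rintro rfl
    exact hv W.zero_mem
  have hinf : W ⊓ F ∙ v = ⊥ :=
    ((Submodule.disjoint_span_singleton' h0).2 hv).eq_bot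
  have := Submodule.finrank_sup_add_finrank_inf_eq W (F ∙ v)
  rwa [hinf, finrank_bot, finrank_span_singleton h0, add_zero] at this

lemma sup_span_singleton_eq {V : Type*} [AddCommGroup V] [Module F V]
    [FiniteDimensional F V] {W U : Submodule F V} {v : V} (hWU : W ≤ U)
    (hU : finrank F U = finrank F W + 1) (hvU : v ∈ U) (hv : v ∉ W) : W ⊔ F ∙ v = U :=
  Submodule.eq_of_le_of_finrank_eq
    (sup_le hWU ((Submodule.span_singleton_le_iff_mem _ _).2 hvU))
    ((finrank_sup_span_singleton_of_notMem hv).trans hU.symm)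

lemma finrank_add_finrank_le {V : Type*} [AddCommGroup V] [Module F V]
    [FiniteDimensional F V] {P Q U : Submodule F V} (hP : P ≤ U) (hQ : Q ≤ U) :
    finrank F P + finrank F Q ≤ finrank F U + finrank F ↥(P ⊓ Q) := by
  have h1 := Submodule.finrank_sup_add_finrank_inf_eq P Q
  have h2 := Submodule.finrank_mono (sup_le hP hQ)
  omega

/-- The intersection of two distinct subspaces of the same dimension is smaller. -/
lemma finrank_inf_lt_of_ne {V : Type*} [AddCommGroup V] [Module F V]
    [FiniteDimensional F V] {P Q : Submodule F V} (h : finrank F P = finrank F Q) (hne : P ≠ Q) :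
    finrank F ↥(P ⊓ Q) < finrank F P := by
  refine Submodule.finrank_lt_finrank_of_lt (inf_le_left.lt_of_ne fun hPQ => hne ?_)
  exact Submodule.eq_of_le_of_finrank_eq (inf_eq_left.1 hPQ) h

lemma mem_coordHyp {n : ℕ} {i : Fin n} {v : Fin n → F} : v ∈ coordHyp F n i ↔ v i = 0 :=
  Iff.rfl

/-- The number of coordinate hyperplanes containing `X` is at most the codimension of `X`. -/
lemma card_add_finrank_le {n : ℕ} (X : Submodule F (Fin n → F)) (I : Finset (Fin n))
    (hI : ∀ i ∈ I, X ≤ coordHyp F n i) : I.card + finrank F X ≤ n := by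
  let f : X →ₗ[F] ({i // i ∉ I} → F) :=
    (LinearMap.funLeft F F (Subtype.val : {i // i ∉ I} → Fin n)).comp X.subtype
  have hf : Function.Injective f := by
    rw [← LinearMap.ker_eq_bot, LinearMap.ker_eq_bot']
    intro x hx
    ext i
    by_cases hi : i ∈ I
    · exact mem_coordHyp.1 (hI i hi x.2)
    · exact congrFun hx ⟨i, hi⟩
  have h1 := LinearMap.finrank_le_finrank_of_injective hf
  rw [Module.finrank_fintype_fun_eq_card, Fintype.card_subtype_compl, Fintype.card_fin,
    Fintype.card_coe] at h1
  have h2 := I.card_le_univ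
  rw [Fintype.card_fin] at h2
  omega

lemma isNondeg_of_mem {n : ℕ} {W : Submodule F (Fin n → F)} {v : Fin n → F} (hv : v ∈ W)
    (h : ∀ i, W ≤ coordHyp F n i → v i ≠ 0) : IsNondeg F n W :=
  fun ⟨i, hi⟩ => h i hi (hi hv)

lemma sup_span_singleton_mem_Sc {n k : ℕ} (hk : 1 < k) {X : Submodule F (Fin n → F)}
    (hX : finrank F X = k - 1) {v : Fin n → F} (hv : v ∉ X)
    (h : ∀ i, X ≤ coordHyp F n i → v i ≠ 0) : X ⊔ F ∙ v ∈ Sc F n k X := by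
  refine ⟨?_, le_sup_left, isNondeg_of_mem
    (Submodule.mem_sup_right (Submodule.mem_span_singleton_self v))
    fun i hi => h i (le_sup_left.trans hi)⟩
  rw [finrank_sup_span_singleton_of_notMem hv]
  omega

lemma exists_mem_Sc_adjK {n k : ℕ} (hk1 : 1 < k) (hk2 : k < n - 1)
    (hF : (↑(n - k) : Cardinal) < Cardinal.mk F)
    {X1 X2 : Submodule F (Fin n → F)} (hX1 : finrank F X1 = k - 1)
    (hX2 : finrank F X2 = k - 1) (h12 : finrank F ↥(X1 ⊓ X2) = k - 2)
    {A : Submodule F (Fin n → F)} (hA : A ∈ Sc F n k X1) :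
    ∃ B ∈ Sc F n k X2, AdjK F n k A B := by
  classical
  obtain ⟨hAk, hXA, hAnd⟩ := hA
  have hn : finrank F (Fin n → F) = n := Module.finrank_fin_fun F
  by_cases hX2A : X2 ≤ A
  · have hAtop : A ≠ ⊤ := by
      rintro rfl
      rw [finrank_top, hn] at hAk
      omega
    obtain ⟨v, hvA, hv⟩ := exists_notMem_forall_ne_zero
      (lt_of_le_of_lt (by exact_mod_cast (show 2 ≤ n - k by omega)) hF) A hAtop
    have hB := sup_span_singleton_mem_Sc hk1 hX2 (fun h => hvA (hX2A h)) fun i _ => hv i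
    have hne : A ≠ X2 ⊔ F ∙ v := fun h =>
      hvA (h ▸ Submodule.mem_sup_right (Submodule.mem_span_singleton_self v))
    refine ⟨_, hB, hne, ?_⟩
    have h1 := finrank_inf_lt_of_ne (hAk.trans hB.1.symm) hne
    have h2 := Submodule.finrank_mono (le_inf hX2A hB.2.1)
    omega
  · have hinf : X1 ⊓ X2 = A ⊓ X2 := by
      refine Submodule.eq_of_le_of_finrank_le (inf_le_inf_right _ hXA) ?_
      have : finrank F ↥(A ⊓ X2) < finrank F X2 :=
        Submodule.finrank_lt_finrank_of_lt
          (inf_le_right.lt_of_ne fun h => hX2A (inf_eq_right.1 h))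
      omega
    obtain ⟨x, hx1, hx2⟩ : ∃ x ∈ X1, x ∉ X2 := by
      refine SetLike.not_le_iff_exists.1 fun h => ?_
      rw [inf_eq_left.2 h] at h12
      omega
    obtain ⟨a, haA, ha1⟩ : ∃ a ∈ A, a ∉ X1 := by
      refine SetLike.not_le_iff_exists.1 fun h => ?_
      have := Submodule.finrank_mono h
      omega
    have hmem : ∀ v ∈ A, v ∈ X2 → v ∈ X1 := fun v hvA hv2 => by
      have : v ∈ X1 ⊓ X2 := hinf ▸ Submodule.mem_inf.2 ⟨hvA, hv2⟩
      exact this.1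
    have hX1eq : X1 ⊓ X2 ⊔ F ∙ x = X1 :=
      sup_span_singleton_eq inf_le_left (by omega) hx1 fun h => hx2 h.2
    have hAeq : X1 ⊔ F ∙ a = A := sup_span_singleton_eq hXA (by omega) haA ha1
    have hcard := card_add_finrank_le X2
      (Finset.univ.filter fun i => X2 ≤ coordHyp F n i) (by simp)
    have hline := exists_combination_ne_zero
      (Finset.univ.filter fun i => X2 ≤ coordHyp F n i) (m := n - k) (by omega) hF a x (by
        intro i hi
        by_contra! h
        refine hAnd ⟨i, ?_⟩
        rw [← hAeq, ← hX1eq]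
        exact sup_le (sup_le (inf_le_right.trans (Finset.mem_filter.1 hi).2)
          ((Submodule.span_singleton_le_iff_mem _ _).2 h.1))
          ((Submodule.span_singleton_le_iff_mem _ _).2 h.2))
    obtain ⟨v, hvA, hv2, hv⟩ : ∃ v ∈ A, v ∉ X2 ∧ ∀ i, X2 ≤ coordHyp F n i → v i ≠ 0 := by
      rcases hline with h | ⟨t, h⟩
      · exact ⟨a, haA, fun h2 => ha1 (hmem a haA h2), fun i hi => h i (by simpa using hi)⟩
      · have hA' : x + t • a ∈ A := A.add_mem (hXA hx1) (A.smul_mem t haA)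
        refine ⟨x + t • a, hA', fun h2 => ?_, fun i hi => h i (by simpa using hi)⟩
        have h3 := (X1.add_mem_iff_right hx1).1 (hmem _ hA' h2)
        by_cases ht : t = 0
        · subst ht
          simp [hx2] at h2
        · exact ha1 ((X1.smul_mem_iff ht).1 h3)
    have hB := sup_span_singleton_mem_Sc hk1 hX2 hv2 hv
    have hne : A ≠ X2 ⊔ F ∙ v := fun h => hX2A (h ▸ le_sup_left)
    refine ⟨_, hB, hne, ?_⟩
    have h1 := finrank_inf_lt_of_ne (hAk.trans hB.1.symm) hne
    have h2 := Submodule.finrank_mono (le_inf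
      (sup_le (hXA.trans' inf_le_left) ((Submodule.span_singleton_le_iff_mem _ _).2 hvA))
      (sup_le_sup_right (inf_le_right : X1 ⊓ X2 ≤ X2) (F ∙ v)))
    rw [finrank_sup_span_singleton_of_notMem fun h : v ∈ X1 ⊓ X2 => hv2 h.2] at h2
    omega

/-- If `X1` and `X2` meet in a subspace of dimension less than `k - 2`, then some member of the star
of `X1` meets `X2` in a subspace of dimension less than `k - 2`. -/
lemma exists_mem_Sc_finrank_inf_lt {n k : ℕ} (hk1 : 1 < k) (hk2 : k < n - 1)
    (hF : (2 : Cardinal) < Cardinal.mk F)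
    {X1 X2 : Submodule F (Fin n → F)} (hX1 : finrank F X1 = k - 1)
    (hX2 : finrank F X2 = k - 1) (h12 : finrank F ↥(X1 ⊓ X2) < k - 2) :
    ∃ A ∈ Sc F n k X1, finrank F ↥(A ⊓ X2) < k - 2 := by
  have hn : finrank F (Fin n → F) = n := Module.finrank_fin_fun F
  by_cases h : finrank F ↥(X1 ⊓ X2) = k - 3
  · have hsup := Submodule.finrank_sup_add_finrank_inf_eq X1 X2
    have htop : X1 ⊔ X2 ≠ ⊤ := by
      intro h
      rw [h, finrank_top, hn] at hsup
      omega
    obtain ⟨v, hvW, hv⟩ := exists_notMem_forall_ne_zero hF _ htop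
    refine ⟨_, sup_span_singleton_mem_Sc hk1 hX1
      (fun h => hvW (Submodule.mem_sup_left h)) fun i _ => hv i, ?_⟩
    refine lt_of_le_of_lt (Submodule.finrank_mono (le_inf ?_ inf_le_right)) h12
    rintro y ⟨hy1, hy2⟩
    obtain ⟨x, hx, z, hz, rfl⟩ := Submodule.mem_sup.1 hy1
    obtain ⟨c, rfl⟩ := Submodule.mem_span_singleton.1 hz
    by_cases hc : c = 0
    · simpa [hc] using hx
    · refine absurd ?_ hvW
      refine ((X1 ⊔ X2).smul_mem_iff hc).1 ?_
      exact ((X1 ⊔ X2).add_mem_iff_right (Submodule.mem_sup_left hx)).1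
        (Submodule.mem_sup_right hy2)
  · have htop : X1 ≠ ⊤ := by
      rintro rfl
      rw [finrank_top, hn] at hX1
      omega
    obtain ⟨v, hvX, hv⟩ := exists_notMem_forall_ne_zero hF _ htop
    have hA := sup_span_singleton_mem_Sc hk1 hX1 hvX fun i _ => hv i
    refine ⟨_, hA, ?_⟩
    have h1 := finrank_add_finrank_le hA.2.1 (inf_le_left : (X1 ⊔ F ∙ v) ⊓ X2 ≤ _)
    rw [hA.1, ← inf_assoc, inf_eq_left.2 hA.2.1] at h1
    omega

end Helpers

/-- for `|F| > n - k` and distinct `(k-1)`-dimensional subspaces `X₁, X₂`,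
`dim (X₁ ∩ X₂) = k - 2` iff every member of each of `S^c(X₁)`, `S^c(X₂)` is adjacent to
some member of the other. -/
theorem stmt8 (F : Type*) [Field F] (n k : ℕ)
    (hk1 : 1 < k) (hk2 : k < n - 1)
    (hF : (↑(n - k) : Cardinal) < Cardinal.mk F)
    (X1 X2 : Submodule F (Fin n → F)) (hX1 : finrank F ↥X1 = k - 1)
    (hX2 : finrank F ↥X2 = k - 1) (hne : X1 ≠ X2) :
    finrank F ↥(X1 ⊓ X2) = k - 2 ↔
      ((∀ A ∈ Sc F n k X1, ∃ B ∈ Sc F n k X2, AdjK F n k A B) ∧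
        (∀ A ∈ Sc F n k X2, ∃ B ∈ Sc F n k X1, AdjK F n k A B)) := by
  have hF2 : (2 : Cardinal) < Cardinal.mk F :=
    lt_of_le_of_lt (by exact_mod_cast (show 2 ≤ n - k by omega)) hF
  constructor
  · exact fun h => ⟨fun A => exists_mem_Sc_adjK hk1 hk2 hF hX1 hX2 h,
      fun A => exists_mem_Sc_adjK hk1 hk2 hF hX2 hX1 (inf_comm X1 X2 ▸ h)⟩
  · rintro ⟨h, -⟩
    have hlt := finrank_inf_lt_of_ne (hX1.trans hX2.symm) hne
    by_contra h12
    obtain ⟨A, hA, hAX⟩ := exists_mem_Sc_finrank_inf_lt hk1 hk2 hF2 hX1 hX2 (by omega)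
    obtain ⟨B, ⟨hBk, hXB, -⟩, -, hAB⟩ := h A hA
    have h1 := finrank_add_finrank_le (inf_le_right : A ⊓ B ≤ B) hXB
    rw [inf_assoc, inf_eq_right.2 hXB] at h1
    omega
end
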